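/- Lifting Theorem (quantitative convergence, Theorem 3.1): Let μ̌ be an S-invariant Borel probability measure on Y, suppose the fibers of T are (ā_n)-shrunk on average with respect to μ̌, and let μ be the unique T-invariant Borel probability measure with π_*μ = μ̌. Then for every (not necessarily invariant) Borel probability measure ν on X with π_*ν = μ̌, every n ∈ ℕ and every 1-Lipschitz function f : X → ℝ one has |∫ f d(T^n_*ν) − ∫ f dμ| ≤ ā_n; in particular T^n_*ν → μ in the weak-* topology of probability measures on X. -/

import Mathlib

open MeasureTheory Filter Topology Metric Set

/-- A modulus of continuity: continuous, increasing, concave on `[0,∞)`, vanishing at `0`. -/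
def IsModulus (ω : ℝ → ℝ) : Prop :=
  ContinuousOn ω (Set.Ici 0) ∧ MonotoneOn ω (Set.Ici 0) ∧
    ConcaveOn ℝ (Set.Ici 0) ω ∧ ω 0 = 0 ∧ ∀ r ∈ Set.Ici (0 : ℝ), 0 ≤ ω r

/-- `T` is uniformly continuous along the fibers of `π`. -/
def UnifContAlongFibers {X Y : Type*} [PseudoMetricSpace X] (T : X → X) (π : X → Y) : Prop :=
  ∃ ω : ℝ → ℝ, IsModulus ω ∧ ∀ x x' : X, π x = π x' → dist (T x) (T x') ≤ ω (dist x x')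

/-- The fibers of `π` are `(a n)`-shrunk on average by `T` with respect to `ν`. -/
def ShrunkOnAverage {X Y : Type*} [PseudoMetricSpace X] [MeasurableSpace Y]
    (T : X → X) (π : X → Y) (ν : MeasureTheory.Measure Y) (a : ℕ → ℝ) : Prop :=
  UnifContAlongFibers T π ∧ (∀ n, 0 < a n) ∧ Filter.Tendsto a Filter.atTop (nhds 0) ∧
    ∀ n : ℕ, (∫ y, Metric.diam (T^[n] '' (π ⁻¹' {y})) ∂ν) ≤ a n

/-- Capacitability: the image of `ℕ → ℕ` under a continuous map is approximated from inside, in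
outer measure, by compact sets. -/
theorem exists_isCompact_subset_range_le_measure {Y : Type*} [TopologicalSpace Y]
    [MeasurableSpace Y] {μ : Measure Y} [μ.OuterRegular] {f : (ℕ → ℕ) → Y} (hf : Continuous f)
    {c : ENNReal} (hc : c < μ (range f)) :
    ∃ K ⊆ range f, IsCompact K ∧ c ≤ μ K := by
  have step : ∀ (k : ℕ) (s : Set (ℕ → ℕ)), ∃ N : ℕ,
      c < μ (f '' s) → c < μ (f '' (s ∩ {x | x k ≤ N})) := by
    intro k s
    by_cases h : c < μ (f '' s)
    · have hU : f '' s = ⋃ N : ℕ, f '' (s ∩ {x | x k ≤ N}) := by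
        rw [← image_iUnion, ← inter_iUnion]
        congr 1
        refine (inter_eq_left.2 fun x _ => mem_iUnion.2 ⟨x k, ?_⟩).symm
        exact le_refl (x k)
      have hmono : Monotone fun N : ℕ => f '' (s ∩ {x | x k ≤ N}) := fun a b hab =>
        image_mono (inter_subset_inter_right _ fun x (hx : x k ≤ a) => hx.trans hab)
      rw [hU, hmono.measure_iUnion, lt_iSup_iff] at h
      obtain ⟨N, hN⟩ := h
      exact ⟨N, fun _ => hN⟩
    · exact ⟨0, fun h' => absurd h' h⟩
  choose N hN using step
  let s : ℕ → Set (ℕ → ℕ) := fun k =>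
    Nat.rec univ (fun k s => s ∩ {x | x k ≤ N k s}) k
  let b : ℕ → ℕ := fun k => N k (s k)
  have hs_succ : ∀ k, s (k + 1) = s k ∩ {x | x k ≤ b k} := fun k => rfl
  have hs : ∀ k, c < μ (f '' s k) := by
    intro k
    induction k with
    | zero => simpa [s] using hc
    | succ k ih => exact hN k (s k) ih
  have hs_le : ∀ k, ∀ x ∈ s k, ∀ i < k, x i ≤ b i := by
    intro k
    induction k with
    | zero => intro x _ i hi; omega
    | succ k ih =>
      intro x hx i hi
      rw [hs_succ] at hx
      rcases Nat.lt_succ_iff_lt_or_eq.1 hi with h | rfl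
      · exact ih x hx.1 i h
      · exact hx.2
  have hK : IsCompact (Icc (0 : ℕ → ℕ) b) := isCompact_Icc
  refine ⟨f '' Icc 0 b, image_subset_range _ _, hK.image hf, ?_⟩
  rw [Set.measure_eq_iInf_isOpen]
  refine le_iInf₂ fun U hU => le_iInf fun hUo => ?_
  suffices ∃ k, s k ⊆ f ⁻¹' U by
    obtain ⟨k, hk⟩ := this
    exact (hs k).le.trans (measure_mono (image_subset_iff.2 hk))
  by_contra! hcon
  have hx : ∀ k, ∃ x ∈ s k, x ∉ f ⁻¹' U := fun k => not_subset.1 (hcon k)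
  choose x hxs hxU using hx
  obtain ⟨y, hy, φ, hφ, hlim⟩ := hK.tendsto_subseq (x := fun k => x k ⊓ b)
    fun k => ⟨fun i => Nat.zero_le _, inf_le_right⟩
  have hlim' : Tendsto (fun k => x (φ k)) atTop (𝓝 y) := by
    rw [tendsto_pi_nhds] at hlim ⊢
    intro i
    refine (hlim i).congr' ?_
    filter_upwards [eventually_gt_atTop i] with k hk
    exact min_eq_left (hs_le (φ k) _ (hxs _) i (hk.trans_le (hφ.id_le k)))
  have hyU : y ∈ (f ⁻¹' U)ᶜ :=
    (hUo.preimage hf).isClosed_compl.mem_of_tendsto hlim' (Eventually.of_forall fun k => hxU _)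
  exact hyU (hU (mem_image_of_mem f hy))

/-- Analytic sets are universally measurable. -/
theorem MeasureTheory.AnalyticSet.nullMeasurableSet {Y : Type*} [TopologicalSpace Y] [T2Space Y]
    [MeasurableSpace Y] [OpensMeasurableSpace Y] {A : Set Y} (hA : AnalyticSet A)
    (μ : Measure Y) [IsFiniteMeasure μ] [μ.OuterRegular] : NullMeasurableSet A μ := by
  rw [AnalyticSet] at hA
  rcases hA with rfl | ⟨f, hf, rfl⟩
  · exact MeasurableSet.empty.nullMeasurableSet
  rcases eq_or_ne (μ (range f)) 0 with h0 | h0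
  · exact NullMeasurableSet.of_null h0
  obtain ⟨c, -, hc, hclim⟩ := exists_seq_strictMono_tendsto' (pos_iff_ne_zero.2 h0)
  choose K hKA hK hcK using fun n =>
    exists_isCompact_subset_range_le_measure (μ := μ) hf (hc n).2
  have hm : MeasurableSet (⋃ n, K n) := .iUnion fun n => (hK n).measurableSet
  refine hm.nullMeasurableSet.congr (ae_eq_of_subset_of_measure_ge (iUnion_subset hKA) ?_
    hm.nullMeasurableSet (measure_ne_top _ _))
  exact le_of_tendsto' hclim fun n => (hcK n).trans (measure_mono (subset_iUnion K n))

/-- The fiberwise supremum of a bounded Borel function is almost everywhere measurable. -/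
theorem aemeasurable_sSup_image_fiber {Z Y : Type*} [MeasurableSpace Z] [StandardBorelSpace Z]
    [TopologicalSpace Y] [T2Space Y] [SecondCountableTopology Y] [MeasurableSpace Y]
    [OpensMeasurableSpace Y] (μ : Measure Y) [IsFiniteMeasure μ] [μ.OuterRegular]
    {p : Z → Y} (hp : Measurable p) (hps : Function.Surjective p)
    {φ : Z → ℝ} (hφ : Measurable φ) (hb : BddAbove (range φ)) :
    AEMeasurable (fun y => sSup (φ '' (p ⁻¹' {y}))) μ := by
  refine NullMeasurable.aemeasurable ?_
  refine measurable_of_Ioi (δ := NullMeasurableSpace Y μ) fun c => ?_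
  have : (fun y => sSup (φ '' (p ⁻¹' {y}))) ⁻¹' Ioi c = p '' (φ ⁻¹' Ioi c) := by
    ext y
    have hne : (φ '' (p ⁻¹' {y})).Nonempty := Set.Nonempty.image φ (hps y)
    simp only [mem_preimage, mem_Ioi, lt_csSup_iff (hb.mono (image_subset_range _ _)) hne,
      mem_image, mem_singleton_iff]
    constructor
    · rintro ⟨_, ⟨z, hz, rfl⟩, h⟩
      exact ⟨z, h, hz⟩
    · rintro ⟨z, h, hz⟩
      exact ⟨_, ⟨z, hz, rfl⟩, h⟩
  have hnull := ((hφ (measurableSet_Ioi (a := c))).analyticSet_image hp).nullMeasurableSet μ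
  rw [← this] at hnull
  exact hnull

/-- A bounded Borel function is dominated in mean by its fiberwise supremum. -/
theorem integral_le_integral_sSup_image_fiber {X Y : Type*} [MeasurableSpace X]
    [StandardBorelSpace X] [TopologicalSpace Y] [T2Space Y] [SecondCountableTopology Y]
    [MeasurableSpace Y] [OpensMeasurableSpace Y] {μ : Measure Y} [IsFiniteMeasure μ]
    [μ.OuterRegular] {p : X → Y} (hp : Measurable p) (hps : Function.Surjective p)
    {ν : Measure X} [IsFiniteMeasure ν] (hν : ν.map p = μ)
    {g : X → ℝ} (hg : Measurable g) {C : ℝ} (hC : ∀ x, |g x| ≤ C) :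
    Integrable (fun y => sSup (g '' (p ⁻¹' {y}))) μ ∧
      ∫ x, g x ∂ν ≤ ∫ y, sSup (g '' (p ⁻¹' {y})) ∂μ := by
  have hb : BddAbove (range g) := ⟨C, forall_mem_range.2 fun x => (abs_le.1 (hC x)).2⟩
  have hle : ∀ x, g x ≤ sSup (g '' (p ⁻¹' {p x})) := fun x =>
    le_csSup (hb.mono (image_subset_range _ _)) ⟨x, rfl, rfl⟩
  have hae := aemeasurable_sSup_image_fiber μ hp hps hg hb
  have hint : Integrable (fun y => sSup (g '' (p ⁻¹' {y}))) μ := by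
    refine Integrable.of_bound hae.aestronglyMeasurable C (Eventually.of_forall fun y => ?_)
    obtain ⟨x, rfl⟩ := hps y
    rw [Real.norm_eq_abs, abs_le]
    refine ⟨(abs_le.1 (hC x)).1.trans (hle x), csSup_le ⟨_, x, rfl, rfl⟩ ?_⟩
    rintro _ ⟨z, -, rfl⟩
    exact (abs_le.1 (hC z)).2
  refine ⟨hint, ?_⟩
  subst hν
  rw [integral_map hp.aemeasurable hint.aestronglyMeasurable]
  exact integral_mono (.of_bound hg.aestronglyMeasurable C (Eventually.of_forall hC))
    (hint.comp_measurable hp) hle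

/-- The diameter of the image of a fiber under a Borel map is an integrable function of the
base point. -/
theorem integrable_diam_image_fiber {X Y : Type*} [MetricSpace X] [CompactSpace X]
    [MeasurableSpace X] [BorelSpace X] [TopologicalSpace Y] [T2Space Y]
    [SecondCountableTopology Y] [MeasurableSpace Y] [BorelSpace Y]
    (μ : Measure Y) [IsFiniteMeasure μ] [μ.OuterRegular]
    {p : X → Y} (hp : Measurable p) (hps : Function.Surjective p)
    {F : X → X} (hF : Measurable F) :
    Integrable (fun y => diam (F '' (p ⁻¹' {y}))) μ := by
  have hbdd : ∀ s : Set X, Bornology.IsBounded s := fun s => isBounded_of_compactSpace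
  let E : Set (X × X) := {z | p z.1 = p z.2}
  have hE : MeasurableSet E := measurableSet_eq_fun (hp.comp measurable_fst) (hp.comp measurable_snd)
  have : StandardBorelSpace E := hE.standardBorel
  let φ : E → ℝ := fun z => dist (F z.1.1) (F z.1.2)
  have hφ : Measurable φ :=
    (hF.comp (measurable_fst.comp measurable_subtype_coe)).dist
      (hF.comp (measurable_snd.comp measurable_subtype_coe))
  have hφb : BddAbove (range φ) :=
    ⟨diam (univ : Set X), forall_mem_range.2 fun z =>
      dist_le_diam_of_mem (hbdd _) (mem_univ _) (mem_univ _)⟩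
  let q : E → Y := fun z => p z.1.1
  have hq : Measurable q := hp.comp (measurable_fst.comp measurable_subtype_coe)
  have hqs : Function.Surjective q := fun y => by
    obtain ⟨x, rfl⟩ := hps y
    exact ⟨⟨(x, x), rfl⟩, rfl⟩
  have heq : (fun y => diam (F '' (p ⁻¹' {y}))) = fun y => sSup (φ '' (q ⁻¹' {y})) := by
    funext y
    refine le_antisymm (diam_le_of_forall_dist_le ?_ ?_) (csSup_le (Set.Nonempty.image φ (hqs y)) ?_)
    · refine Real.sSup_nonneg ?_
      rintro _ ⟨z, -, rfl⟩
      exact dist_nonneg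
    · rintro _ ⟨x, hx, rfl⟩ _ ⟨x', hx', rfl⟩
      refine le_csSup (hφb.mono (image_subset_range _ _)) ⟨⟨(x, x'), ?_⟩, hx, rfl⟩
      exact Eq.trans hx (Eq.symm hx')
    · rintro _ ⟨z, hz, rfl⟩
      have hz' : p z.1.1 = y := hz
      exact dist_le_diam_of_mem (hbdd _) ⟨_, hz', rfl⟩ ⟨_, z.2.symm.trans hz', rfl⟩
  refine Integrable.of_bound (C := diam (univ : Set X)) ?_ (Eventually.of_forall fun y => ?_)
  · rw [heq]
    exact (aemeasurable_sSup_image_fiber μ hq hqs hφ hφb).aestronglyMeasurable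
  · rw [Real.norm_of_nonneg diam_nonneg]
    exact diam_mono (subset_univ _) (hbdd _)

/-- Two lifts of the same measure, pushed forward by a Borel map `F`, differ on `1`-Lipschitz
functions by at most the mean diameter of the images of the fibers. -/
theorem integral_map_sub_integral_map_le_integral_diam {X Y : Type*} [MetricSpace X]
    [CompactSpace X] [MeasurableSpace X] [BorelSpace X] [TopologicalSpace Y] [T2Space Y]
    [SecondCountableTopology Y] [MeasurableSpace Y] [BorelSpace Y]
    {m : Measure Y} [IsFiniteMeasure m] [m.OuterRegular]
    {p : X → Y} (hp : Measurable p) (hps : Function.Surjective p)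
    {F : X → X} (hF : Measurable F) {μ ν : Measure X} [IsFiniteMeasure μ] [IsFiniteMeasure ν]
    (hμ : μ.map p = m) (hν : ν.map p = m) {f : X → ℝ} (hf : LipschitzWith 1 f) :
    ∫ x, f x ∂(ν.map F) - ∫ x, f x ∂(μ.map F) ≤ ∫ y, diam (F '' (p ⁻¹' {y})) ∂m := by
  have hfc := hf.continuous
  obtain ⟨C, hC⟩ : ∃ C, ∀ x, |f x| ≤ C := by
    obtain ⟨C, hC⟩ := isCompact_univ.exists_bound_of_continuousOn hfc.continuousOn
    exact ⟨C, fun x => hC x (mem_univ x)⟩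
  have hg : Measurable (f ∘ F) := hfc.measurable.comp hF
  obtain ⟨hi₁, h₁⟩ := integral_le_integral_sSup_image_fiber hp hps hν hg (fun x => hC (F x))
  obtain ⟨hi₂, h₂⟩ := integral_le_integral_sSup_image_fiber hp hps hμ hg.neg (C := C)
    (fun x => by simpa using hC (F x))
  rw [integral_map hF.aemeasurable hfc.measurable.aestronglyMeasurable,
    integral_map hF.aemeasurable hfc.measurable.aestronglyMeasurable]
  have h₃ := integral_mono (hi₁.add hi₂) (integrable_diam_image_fiber m hp hps hF) (by
    intro y
    have hne : (p ⁻¹' {y}).Nonempty := hps y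
    rw [Pi.add_apply, ← le_sub_iff_add_le]
    refine csSup_le (hne.image _) ?_
    rintro _ ⟨x, hx, rfl⟩
    rw [le_sub_comm]
    refine csSup_le (hne.image _) ?_
    rintro _ ⟨x', hx', rfl⟩
    have h₄ : dist (F x) (F x') ≤ diam (F '' (p ⁻¹' {y})) :=
      dist_le_diam_of_mem isBounded_of_compactSpace ⟨x, hx, rfl⟩ ⟨x', hx', rfl⟩
    have h₅ := (le_abs_self _).trans (hf.dist_le_mul (F x) (F x'))
    simp only [NNReal.coe_one, one_mul] at h₅
    simp only [Pi.neg_apply, Function.comp_apply]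
    linarith)
  rw [integral_add' hi₁ hi₂] at h₃
  simp only [Pi.neg_apply, integral_neg, Function.comp_apply] at h₁ h₂ h₃
  linarith

/-- On a compact metric space, convergence of the integrals of `1`-Lipschitz functions implies
convergence of the integrals of continuous functions. -/
theorem tendsto_integral_of_forall_lipschitzWith_one {X : Type*} [MetricSpace X] [CompactSpace X]
    [MeasurableSpace X] [BorelSpace X] {μs : ℕ → Measure X} {μ : Measure X}
    (hμs : ∀ n, IsProbabilityMeasure (μs n)) [hμ : IsProbabilityMeasure μ]
    (h : ∀ f : X → ℝ, LipschitzWith 1 f →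
      Tendsto (fun n => ∫ x, f x ∂(μs n)) atTop (𝓝 (∫ x, f x ∂μ)))
    {g : X → ℝ} (hg : Continuous g) :
    Tendsto (fun n => ∫ x, g x ∂(μs n)) atTop (𝓝 (∫ x, g x ∂μ)) := by
  let P : ℕ → ProbabilityMeasure X := fun n => ⟨μs n, hμs n⟩
  let P₀ : ProbabilityMeasure X := ⟨μ, hμ⟩
  have hlim : Tendsto P atTop (𝓝 P₀) := by
    rw [tendsto_iff_forall_lipschitz_integral_tendsto]
    rintro f - ⟨L, hL⟩
    have hpos : (0 : ℝ) < L + 1 := by positivity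
    have hL' : LipschitzWith 1 fun x => ((L : ℝ) + 1)⁻¹ * f x := by
      refine LipschitzWith.of_dist_le_mul fun x y => ?_
      rw [Real.dist_eq, ← mul_sub, abs_mul, abs_of_pos (inv_pos.2 hpos), NNReal.coe_one, one_mul,
        inv_mul_le_iff₀ hpos]
      refine (hL.dist_le_mul x y).trans ?_
      gcongr
      linarith
    have := (h _ hL').const_mul ((L : ℝ) + 1)
    simp only [integral_const_mul, mul_inv_cancel_left₀ hpos.ne'] at this
    exact this
  exact ProbabilityMeasure.tendsto_iff_forall_integral_tendsto.1 hlim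
    (BoundedContinuousFunction.mkOfCompact ⟨g, hg⟩)

/-- Lifting Theorem (quantitative convergence): if the fibers of the extension `T` of `S`
are `(a n)`-shrunk on average with respect to the `S`-invariant probability measure `μY`,
and `μ` is the unique `T`-invariant probability lift of `μY`, then for every probability
measure `ν` on `X` projecting to `μY`, every `n` and every `1`-Lipschitz `f : X → ℝ` one has
`|∫ f d(T^n_* ν) − ∫ f dμ| ≤ a n`; in particular `T^n_* ν → μ` in the weak-* topology. -/
theorem lifting_quantitative_convergence
    {X Y : Type*} [MetricSpace X] [CompactSpace X] [MeasurableSpace X] [BorelSpace X]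
    [MetricSpace Y] [CompactSpace Y] [MeasurableSpace Y] [BorelSpace Y]
    (T : X → X) (S : Y → Y) (π : X → Y)
    (hT : Measurable T) (hS : Measurable S)
    (hπc : Continuous π) (hπs : Function.Surjective π)
    (hcomm : ∀ x, π (T x) = S (π x))
    (μY : Measure Y) [IsProbabilityMeasure μY] (hμYinv : Measure.map S μY = μY)
    (a : ℕ → ℝ) (hshrink : ShrunkOnAverage T π μY a)
    (μ : Measure X) [IsProbabilityMeasure μ]
    (hμinv : Measure.map T μ = μ) (hμlift : Measure.map π μ = μY)
    (ν : Measure X) [IsProbabilityMeasure ν] (hνlift : Measure.map π ν = μY) :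
    (∀ (n : ℕ) (f : X → ℝ), LipschitzWith 1 f →
        |(∫ x, f x ∂(Measure.map T^[n] ν)) - ∫ x, f x ∂μ| ≤ a n) ∧
      ∀ g : X → ℝ, Continuous g →
        Filter.Tendsto (fun n : ℕ => ∫ x, g x ∂(Measure.map T^[n] ν)) Filter.atTop
          (nhds (∫ x, g x ∂μ)) := by
  obtain ⟨-, -, ha, hdiam⟩ := hshrink
  have hTn : ∀ n, Measurable T^[n] := fun n => hT.iterate n
  have hμn : ∀ n, Measure.map T^[n] μ = μ := fun n =>
    ((⟨hT, hμinv⟩ : MeasurePreserving T μ μ).iterate n).map_eq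
  have key : ∀ (n : ℕ) (f : X → ℝ), LipschitzWith 1 f →
      |(∫ x, f x ∂(Measure.map T^[n] ν)) - ∫ x, f x ∂μ| ≤ a n := by
    intro n f hf
    have h₁ := integral_map_sub_integral_map_le_integral_diam hπc.measurable hπs (hTn n)
      hμlift hνlift hf
    have h₂ := integral_map_sub_integral_map_le_integral_diam hπc.measurable hπs (hTn n)
      hνlift hμlift hf
    rw [hμn n] at h₁ h₂
    have h₃ := hdiam n
    exact abs_sub_le_iff.2 ⟨h₁.trans h₃, h₂.trans h₃⟩
  refine ⟨key, fun g hg => tendsto_integral_of_forall_lipschitzWith_one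
    (fun n => Measure.isProbabilityMeasure_map (hTn n).aemeasurable) (fun f hf => ?_) hg⟩
  rw [tendsto_iff_dist_tendsto_zero]
  exact squeeze_zero (fun _ => dist_nonneg) (fun n => key n f hf) ha
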